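/- arXiv:2412.11833 — 7 statements merged into one kernel-verified Lean document; each statement's English description precedes it below -/
import Mathlib

section
/- Let A ∈ ℝ^{n×n} be a symmetric matrix and b ∈ ℝ^n, and define f(x) = ⟨Ax, x⟩ − ⟨|x|, x⟩ − 2⟨b, x⟩ for x ∈ ℝ^n, where |x| denotes the componentwise absolute value. Then f is continuously differentiable on ℝ^n and its gradient is ∇f(x) = 2(Ax − |x| − b) for every x ∈ ℝ^n. -/
open Matrix

lemma aux_abs (t : ℝ) : HasDerivAt (fun s : ℝ => |s| * s) (2 * |t|) t := by
  rcases lt_trichotomy t 0 with h | h | h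
  · have := (hasDerivAt_abs_neg h).mul (hasDerivAt_id t)
    refine this.congr_deriv ?_
    rw [abs_of_neg h]; simp only [id]; ring
  · subst h
    rw [hasDerivAt_iff_tendsto_slope]
    have h1 : Filter.Tendsto (fun s : ℝ => |s|) (nhdsWithin 0 {0}ᶜ) (nhds (2 * |0|)) := by
      have : Filter.Tendsto (fun s : ℝ => |s|) (nhds 0) (nhds |0|) := continuous_abs.tendsto 0
      simpa using this.mono_left nhdsWithin_le_nhds
    refine h1.congr' ?_
    filter_upwards [self_mem_nhdsWithin] with s hs
    have : s ≠ 0 := hs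
    simp [slope_def_field, this]
  · have := (hasDerivAt_abs_pos h).mul (hasDerivAt_id t)
    refine this.congr_deriv ?_
    rw [abs_of_pos h]; simp only [id]; ring

/-- `f(x) = ⟨Ax, x⟩ - ⟨|x|, x⟩ - 2⟨b, x⟩` (with `A` symmetric) is continuously differentiable
on `ℝⁿ` and its gradient is `∇f(x) = 2(Ax - |x| - b)`. -/
theorem stmt_0 (n : ℕ) (A : Matrix (Fin n) (Fin n) ℝ) (hA : A.IsSymm)
    (b : EuclideanSpace ℝ (Fin n)) :
    let toE : (Fin n → ℝ) → EuclideanSpace ℝ (Fin n) := (WithLp.equiv 2 (Fin n → ℝ)).symm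
    let f : EuclideanSpace ℝ (Fin n) → ℝ := fun x =>
      inner (𝕜 := ℝ) (toE (A.mulVec x)) x
        - inner (𝕜 := ℝ) (toE fun i => |x i|) x
        - 2 * inner (𝕜 := ℝ) b x
    ContDiff ℝ 1 f ∧
      ∀ x : EuclideanSpace ℝ (Fin n),
        HasGradientAt f ((2 : ℝ) • (toE (A.mulVec x) - toE (fun i => |x i|) - b)) x := by
  intro toE f
  have key : ∀ x : EuclideanSpace ℝ (Fin n),
        HasGradientAt f ((2 : ℝ) • (toE (A.mulVec x) - toE (fun i => |x i|) - b)) x := by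
    intro x
    rw [hasGradientAt_iff_hasFDerivAt]
    have hf : f = fun x => ∑ i, ((∑ j, A i j * x j) * x i - |x i| * x i - 2 * b i * x i) := by
      funext x
      simp only [f, toE, PiLp.inner_apply, Finset.sum_sub_distrib, mulVec,
        dotProduct, WithLp.equiv_symm_apply, RCLike.inner_apply, conj_trivial]
      congr 1
      · congr 1 <;> exact Finset.sum_congr rfl fun i _ => mul_comm _ _
      · rw [Finset.mul_sum]
        exact Finset.sum_congr rfl fun i _ => by ring
    rw [hf]
    have hp : ∀ i, HasFDerivAt (fun y : EuclideanSpace ℝ (Fin n) => y i)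
        (EuclideanSpace.proj i : EuclideanSpace ℝ (Fin n) →L[ℝ] ℝ) x :=
      fun i => (EuclideanSpace.proj i : EuclideanSpace ℝ (Fin n) →L[ℝ] ℝ).hasFDerivAt
    have hd := HasFDerivAt.fun_sum (u := Finset.univ) fun i (_ : i ∈ Finset.univ) =>
      (((HasFDerivAt.fun_sum (u := Finset.univ) fun j (_ : j ∈ Finset.univ) =>
        (hp j).const_mul (A i j)).mul (hp i)).sub
        ((aux_abs (x i)).comp_hasFDerivAt x (hp i))).sub ((hp i).const_mul (2 * b i))
    refine hd.congr_fderiv ?_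
    ext v
    have e : ∑ i, x i * ∑ j, A i j * v j = ∑ i, v i * ∑ j, A i j * x j := by
      simp only [Finset.mul_sum]
      rw [Finset.sum_comm]
      refine Finset.sum_congr rfl fun i _ => Finset.sum_congr rfl fun j _ => ?_
      rw [hA.apply i j]; ring
    have e2 : ∑ i, 2 * |x i| * v i = 2 * ∑ i, v i * |x i| := by
      rw [Finset.mul_sum]
      exact Finset.sum_congr rfl fun i _ => by ring
    have e4 : ∑ i, 2 * b i * v i = 2 * ∑ i, v i * b i := by
      rw [Finset.mul_sum]
      exact Finset.sum_congr rfl fun i _ => by ring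
    have e3 : ∑ i, (∑ j, A i j * x j) * v i = ∑ i, v i * ∑ j, A i j * x j :=
      Finset.sum_congr rfl fun i _ => mul_comm _ _
    simp [toE, PiLp.inner_apply, mulVec, dotProduct, Finset.sum_sub_distrib,
      Finset.sum_add_distrib]
    linarith
  refine ⟨?_, key⟩
  rw [contDiff_one_iff_hasFDerivAt]
  refine ⟨_, ?_, fun x => (key x).hasFDerivAt⟩
  refine (InnerProductSpace.toDual ℝ _).continuous.comp ?_
  have h1 : Continuous fun x : EuclideanSpace ℝ (Fin n) => toE (A.mulVec x) := by
    refine (PiLp.continuous_toLp 2 _).comp ?_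
    exact Continuous.matrix_mulVec continuous_const (PiLp.continuous_ofLp 2 _)
  have h2 : Continuous fun x : EuclideanSpace ℝ (Fin n) => toE (fun i => |x i|) := by
    refine (PiLp.continuous_toLp 2 _).comp ?_
    fun_prop
  exact ((h1.sub h2).sub (continuous_const (y := b))).const_smul (2 : ℝ)
end

section
/- Let A ∈ ℝ^{n×n} be such that A − I is a symmetric positive definite matrix, and let g(x) = 2(Ax − |x| − b) for a fixed b ∈ ℝ^n. Then g is strongly monotone on ℝ^n: for all x, y ∈ ℝ^n, ⟨g(x) − g(y), x − y⟩ ≥ 2 λ_min(A − I) ‖x − y‖², where λ_min(A − I) > 0 is the smallest eigenvalue of A − I. -/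
open Matrix

theorem rayleigh_aux {n : ℕ} {B : Matrix (Fin n) (Fin n) ℝ} (hB : B.IsHermitian)
    (z : EuclideanSpace ℝ (Fin n)) :
    (⨅ i, hB.eigenvalues i) * ‖z‖ ^ 2 ≤ inner ℝ (WithLp.toLp 2 (B.mulVec z)) z := by
  have key : ∀ i, inner ℝ (WithLp.toLp 2 (B.mulVec z)) (hB.eigenvectorBasis i)
      = hB.eigenvalues i * inner ℝ z (hB.eigenvectorBasis i) := by
    intro i
    have h := hB.mulVec_eigenvectorBasis i
    have hT : Bᵀ = B := by simpa [Matrix.IsHermitian] using hB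
    simp only [EuclideanSpace.inner_eq_star_dotProduct, star_trivial]
    rw [Matrix.dotProduct_mulVec, ← Matrix.mulVec_transpose, hT, h, smul_dotProduct, smul_eq_mul]
  rw [← hB.eigenvectorBasis.sum_inner_mul_inner, ← real_inner_self_eq_norm_sq,
    ← hB.eigenvectorBasis.sum_inner_mul_inner, Finset.mul_sum]
  refine Finset.sum_le_sum fun i _ => ?_
  rw [key, real_inner_comm z, mul_assoc]
  exact mul_le_mul_of_nonneg_right (ciInf_le (Set.finite_range _).bddBelow i) (mul_self_nonneg _)

/-- If `A - I` is symmetric positive definite, then `g(x) = 2(Ax - |x| - b)` is strongly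
monotone: `⟨g(x) - g(y), x - y⟩ ≥ 2 λ_min(A - I) ‖x - y‖²`. -/
theorem stmt_2 (n : ℕ) (A : Matrix (Fin n) (Fin n) ℝ) (hA : (A - 1).PosDef)
    (b : EuclideanSpace ℝ (Fin n)) :
    let toE : (Fin n → ℝ) → EuclideanSpace ℝ (Fin n) := (WithLp.equiv 2 (Fin n → ℝ)).symm
    let g : EuclideanSpace ℝ (Fin n) → EuclideanSpace ℝ (Fin n) := fun x =>
      (2 : ℝ) • (toE (A.mulVec x) - toE (fun i => |x i|) - b)
    ∀ x y : EuclideanSpace ℝ (Fin n),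
      inner (𝕜 := ℝ) (g x - g y) (x - y) ≥
        2 * (⨅ i, hA.1.eigenvalues i) * ‖x - y‖ ^ 2 := by
  intro toE g x y
  have h := rayleigh_aux hA.1 (x - y)
  have hc : inner ℝ (WithLp.toLp 2 ((A - 1).mulVec (x - y))) (x - y) * 2
      ≤ inner ℝ (g x - g y) (x - y) := by
    simp only [PiLp.inner_apply, Finset.sum_mul]
    refine Finset.sum_le_sum fun i _ => ?_
    have e1 : (g x - g y) i = 2 * ((A.mulVec x i - |x i| - b i) - (A.mulVec y i - |y i| - b i)) := by
      simp [g, toE]; ring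
    have e2 : (A - 1).mulVec (x - y) i = A.mulVec x i - A.mulVec y i - (x i - y i) := by
      simp [Matrix.sub_mulVec, Matrix.mulVec_sub]; ring
    have h3 : (|x i| - |y i|) * (x i - y i) ≤ (x i - y i) * (x i - y i) := by
      refine (le_abs_self _).trans ?_
      rw [abs_mul, ← abs_mul_abs_self (x i - y i)]
      exact mul_le_mul_of_nonneg_right (abs_abs_sub_abs_le _ _) (abs_nonneg _)
    simp only [RCLike.inner_apply, conj_trivial, e1, PiLp.sub_apply]
    erw [e2]
    nlinarith
  rw [WithLp.ofLp_sub] at h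
  linarith
end

section
/- Let A ∈ ℝ^{n×n} be such that A − I is a symmetric positive definite matrix. Then for any b ∈ ℝ^n, the absolute value equation Ax − |x| = b has exactly one solution x ∈ ℝ^n. -/
lemma ave_coer (n : ℕ) (P : Matrix (Fin n) (Fin n) ℝ) (hP : P.PosDef) :
    ∃ l : ℝ, 0 < l ∧ ∀ x : EuclideanSpace ℝ (Fin n),
      l * ‖x‖ ^ 2 ≤ inner ℝ x (Matrix.toEuclideanLin P x) := by
  have hpos : ∀ x : EuclideanSpace ℝ (Fin n), x ≠ 0 →
      0 < inner ℝ x (Matrix.toEuclideanLin P x) := by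
    intro x hx
    have h := hP.dotProduct_mulVec_pos (x := x.ofLp) (by simpa using hx)
    simpa [PiLp.inner_apply, dotProduct, mul_comm] using h
  have hcont : Continuous fun x : EuclideanSpace ℝ (Fin n) =>
      (inner ℝ x (Matrix.toEuclideanLin P x) : ℝ) :=
    continuous_id.inner (LinearMap.continuous_of_finiteDimensional _)
  rcases (Metric.sphere (0 : EuclideanSpace ℝ (Fin n)) 1).eq_empty_or_nonempty with he | hne
  · refine ⟨1, one_pos, fun x => ?_⟩
    by_cases hx : x = 0
    · simp [hx]
    · exfalso
      have : (‖x‖⁻¹ • x) ∈ Metric.sphere (0 : EuclideanSpace ℝ (Fin n)) 1 := by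
        simp [norm_smul, hx]
      rw [he] at this
      exact this
  · obtain ⟨y, hy, hmin⟩ := (isCompact_sphere (0 : EuclideanSpace ℝ (Fin n)) 1).exists_isMinOn
      hne hcont.continuousOn
    have hy0 : y ≠ 0 := by
      rintro rfl
      simp at hy
    refine ⟨_, hpos y hy0, fun x => ?_⟩
    by_cases hx : x = 0
    · simp [hx]
    · have hm : (‖x‖⁻¹ • x) ∈ Metric.sphere (0 : EuclideanSpace ℝ (Fin n)) 1 := by
        simp [norm_smul, hx]
      have h := hmin hm
      simp only [Set.mem_ofPred_eq, map_smul, inner_smul_left, inner_smul_right,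
        conj_trivial] at h
      have hn : 0 < ‖x‖ := norm_pos_iff.mpr hx
      calc _ ≤ (‖x‖⁻¹ * (‖x‖⁻¹ * inner ℝ x (Matrix.toEuclideanLin P x))) * ‖x‖ ^ 2 := by
            gcongr
        _ = _ := by field_simp

/-- If `A - I` is symmetric positive definite, then for any `b` the absolute value equation
`Ax - |x| = b` has exactly one solution. -/
theorem stmt_3 (n : ℕ) (A : Matrix (Fin n) (Fin n) ℝ)
    (hA : (A - 1).PosDef) (b : Fin n → ℝ) :
    ∃! x : Fin n → ℝ, A.mulVec x - (fun i => |x i|) = b := by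
  obtain ⟨l, hl, hq⟩ := ave_coer n _ hA
  have hb : ∀ x : EuclideanSpace ℝ (Fin n),
      (1 + l) * ‖x‖ ≤ ‖Matrix.toEuclideanLin A x‖ := by
    intro x
    by_cases hx : x = 0
    · simp [hx]
    have hn : 0 < ‖x‖ := norm_pos_iff.mpr hx
    have h1 := hq x
    have h2 : Matrix.toEuclideanLin (A - 1) x = Matrix.toEuclideanLin A x - x := by
      ext i
      simp [Matrix.sub_mulVec]
    rw [h2, inner_sub_right, real_inner_self_eq_norm_sq] at h1
    have h3 := real_inner_le_norm x (Matrix.toEuclideanLin A x)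
    by_contra! h
    nlinarith
  have hinj : Function.Injective (Matrix.toEuclideanLin A) := by
    rw [injective_iff_map_eq_zero]
    intro x hx
    have := hb x
    rw [hx, norm_zero] at this
    have h0 := norm_nonneg x
    exact norm_eq_zero.mp (by nlinarith)
  have hsurj := LinearMap.injective_iff_surjective.mp hinj
  let g : EuclideanSpace ℝ (Fin n) → EuclideanSpace ℝ (Fin n) :=
    fun x => WithLp.toLp 2 (fun i => |x i| + b i)
  have hg : ∀ x y, ‖g x - g y‖ ≤ ‖x - y‖ := by
    intro x y
    rw [EuclideanSpace.norm_eq, EuclideanSpace.norm_eq]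
    gcongr with i
    simpa [g] using abs_abs_sub_abs_le (x i) (y i)
  choose f hf using fun x => hsurj (g x)
  have hK : (0 : ℝ) ≤ (1 + l)⁻¹ := by positivity
  have hc : ContractingWith ⟨(1 + l)⁻¹, hK⟩ f := by
    constructor
    · change (1 + l)⁻¹ < (1 : ℝ)
      exact inv_lt_one_of_one_lt₀ (by linarith : 1 < 1 + l)
    · refine LipschitzWith.of_dist_le_mul fun x y => ?_
      rw [dist_eq_norm, dist_eq_norm]
      have h1 := hb (f x - f y)
      rw [map_sub, hf, hf] at h1
      have h2 := h1.trans (hg x y)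
      change _ ≤ (1 + l)⁻¹ * _
      rw [inv_mul_eq_div, le_div_iff₀ (by positivity)]
      linarith
  have key : ∀ x : EuclideanSpace ℝ (Fin n),
      A.mulVec x.ofLp - (fun i => |x i|) = b ↔ Function.IsFixedPt f x := by
    intro x
    rw [Function.IsFixedPt, ← hinj.eq_iff, hf, eq_comm (a := g x), sub_eq_iff_eq_add']
    constructor
    · intro h
      ext i
      simpa [g] using congrFun h i
    · intro h
      funext i
      simpa [g] using congrArg (fun v : EuclideanSpace ℝ (Fin n) => v i) h
  refine ⟨(ContractingWith.fixedPoint f hc).ofLp, (key _).mpr hc.fixedPoint_isFixedPt, ?_⟩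
  intro y hy
  have := hc.fixedPoint_unique ((key (WithLp.toLp 2 y)).mp hy)
  rw [← this]
end

section
/- Let A ∈ ℝ^{n×n} be such that A − I is a symmetric positive definite matrix, let b ∈ ℝ^n, and define f(x) = ⟨Ax, x⟩ − ⟨|x|, x⟩ − 2⟨b, x⟩. Then f has a unique global minimum point on ℝ^n, and a point x_* ∈ ℝ^n is the unique global minimizer of f if and only if it is the unique solution of the absolute value equation Ax_* − |x_*| = b. -/
open Matrix

lemma aux_scalar (t s : ℝ) :
    (2*t-2*|t|)*s ≤ ((t+s)^2 - |t+s| * (t+s)) - (t^2 - |t| * t) ∧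
    ((t+s)^2 - |t+s| * (t+s)) - (t^2 - |t| * t) ≤ (2*t-2*|t|)*s + 2*s^2 := by
  rcases abs_cases t with ⟨h1, h1'⟩ | ⟨h1, h1'⟩ <;>
  rcases abs_cases (t+s) with ⟨h2, h2'⟩ | ⟨h2, h2'⟩ <;> rw [h1, h2] <;>
  constructor <;>
  nlinarith [sq_nonneg s, sq_nonneg (t+s), sq_nonneg t,
    sq_nonneg (t - s)]

/-- The function to minimise. -/
def auxF {n : ℕ} (A : Matrix (Fin n) (Fin n) ℝ) (b x : Fin n → ℝ) : ℝ :=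
  A.mulVec x ⬝ᵥ x - (fun i => |x i|) ⬝ᵥ x - 2 * (b ⬝ᵥ x)

lemma aux_expand {n : ℕ} (A : Matrix (Fin n) (Fin n) ℝ)
    (hA : (A - 1).PosDef) (b x d : Fin n → ℝ) :
    auxF A b (x + d) = auxF A b x + 2 * ((A.mulVec x - (fun i => |x i|) - b) ⬝ᵥ d)
      + (A - 1).mulVec d ⬝ᵥ d
      + ∑ i, ((((x i+d i)^2 - |x i+d i| * (x i+d i)) - (x i^2 - |x i| * x i))
          - (2*x i-2*|x i|)*d i) := by
  have hs : Aᵀ = A := by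
    have h := hA.isHermitian.eq
    simpa using h
  have h1 : A.mulVec d ⬝ᵥ x = A.mulVec x ⬝ᵥ d := by
    rw [dotProduct_comm, dotProduct_mulVec, ← mulVec_transpose, hs]
  have h2 : ∑ i, ((((x i+d i)^2 - |x i+d i| * (x i+d i)) - (x i^2 - |x i| * x i))
          - (2*x i-2*|x i|)*d i) =
      d ⬝ᵥ d - (fun i => |(x + d) i|) ⬝ᵥ (x + d) + (fun i => |x i|) ⬝ᵥ x
        + 2 * ((fun i => |x i|) ⬝ᵥ d) := by
    simp only [dotProduct, Finset.mul_sum, ← Finset.sum_add_distrib, ← Finset.sum_sub_distrib]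
    apply Finset.sum_congr rfl
    intro i _
    simp only [Pi.add_apply]
    ring
  rw [h2]
  simp only [auxF, mulVec_add, sub_mulVec, one_mulVec, add_dotProduct, dotProduct_add,
    sub_dotProduct, h1]
  ring

lemma aux_pos {n : ℕ} {B : Matrix (Fin n) (Fin n) ℝ} (hB : B.PosDef) (d : Fin n → ℝ)
    (hd : d ≠ 0) : 0 < B.mulVec d ⬝ᵥ d := by
  have := hB.dotProduct_mulVec_pos hd
  rwa [star_trivial, dotProduct_comm] at this

lemma aux_lower {n : ℕ} (A : Matrix (Fin n) (Fin n) ℝ)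
    (hA : (A - 1).PosDef) (b x d : Fin n → ℝ) :
    auxF A b x + 2 * ((A.mulVec x - (fun i => |x i|) - b) ⬝ᵥ d)
      + (A - 1).mulVec d ⬝ᵥ d ≤ auxF A b (x + d) := by
  rw [aux_expand A hA]
  have : 0 ≤ ∑ i, ((((x i+d i)^2 - |x i+d i| * (x i+d i)) - (x i^2 - |x i| * x i))
          - (2*x i-2*|x i|)*d i) :=
    Finset.sum_nonneg fun i _ => sub_nonneg.2 (aux_scalar _ _).1
  linarith

lemma aux_upper {n : ℕ} (A : Matrix (Fin n) (Fin n) ℝ)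
    (hA : (A - 1).PosDef) (b x d : Fin n → ℝ) :
    auxF A b (x + d) ≤ auxF A b x + 2 * ((A.mulVec x - (fun i => |x i|) - b) ⬝ᵥ d)
      + (A - 1).mulVec d ⬝ᵥ d + 2 * (d ⬝ᵥ d) := by
  rw [aux_expand A hA]
  have : ∑ i, ((((x i+d i)^2 - |x i+d i| * (x i+d i)) - (x i^2 - |x i| * x i))
          - (2*x i-2*|x i|)*d i) ≤ 2 * (d ⬝ᵥ d) := by
    rw [dotProduct, Finset.mul_sum]
    refine Finset.sum_le_sum fun i _ => ?_
    have := (aux_scalar (x i) (d i)).2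
    nlinarith
  linarith

lemma aux_iff {n : ℕ} (A : Matrix (Fin n) (Fin n) ℝ)
    (hA : (A - 1).PosDef) (b x : Fin n → ℝ) :
    (∀ y, auxF A b x ≤ auxF A b y) ↔ A.mulVec x - (fun i => |x i|) = b := by
  constructor
  · intro h
    rw [← sub_eq_zero]
    set v := A.mulVec x - (fun i => |x i|) - b with hv
    by_contra hne
    have hvv : 0 < v ⬝ᵥ v := by
      have := aux_pos (B := (1 : Matrix (Fin n) (Fin n) ℝ)) PosDef.one v hne
      rwa [one_mulVec] at this
    have hB := aux_pos hA v hne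
    set p := v ⬝ᵥ v
    set q := (A - 1).mulVec v ⬝ᵥ v
    have key : ∀ t : ℝ, 0 ≤ 2 * (t * p) + t * (t * q) + 2 * (t * (t * p)) := by
      intro t
      have h1 := h (x + t • v)
      have h2 := aux_upper A hA b x (t • v)
      rw [← hv] at h2
      simp only [mulVec_smul, dotProduct_smul, smul_dotProduct, smul_eq_mul] at h2
      linarith
    have := key (-(p / (q + 2 * p)))
    have hz : 0 < q + 2 * p := by positivity
    have e : 2 * (-(p / (q + 2 * p)) * p) + -(p / (q + 2 * p)) * (-(p / (q + 2 * p)) * q)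
      + 2 * (-(p / (q + 2 * p)) * (-(p / (q + 2 * p)) * p)) = - (p^2 / (q + 2 * p)) := by
      field_simp
      ring
    rw [e] at this
    have : 0 < p^2 / (q + 2 * p) := by positivity
    linarith
  · intro h y
    have h2 := aux_lower A hA b x (y - x)
    rw [h, sub_self, zero_dotProduct, add_sub_cancel] at h2
    by_cases hd : y - x = 0
    · rw [sub_eq_zero.1 hd]
    · have := aux_pos hA _ hd
      linarith

lemma aux_coercive {n : ℕ} {B : Matrix (Fin n) (Fin n) ℝ} (hB : B.PosDef) :
    ∃ c : ℝ, 0 < c ∧ ∀ d : Fin n → ℝ, c * ‖d‖ ^ 2 ≤ B.mulVec d ⬝ᵥ d := by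
  have hc : Continuous fun d : Fin n → ℝ => B.mulVec d ⬝ᵥ d := by fun_prop
  rcases (Metric.sphere (0 : Fin n → ℝ) 1).eq_empty_or_nonempty with he | hne
  · refine ⟨1, one_pos, fun d => ?_⟩
    by_cases hd : d = 0
    · simp [hd]
    · exfalso
      have : (‖d‖⁻¹ • d) ∈ Metric.sphere (0 : Fin n → ℝ) 1 := by
        simp [norm_smul, hd]
      simp [he] at this
  · obtain ⟨u, hu, hm⟩ := (isCompact_sphere (0 : Fin n → ℝ) 1).exists_isMinOn hne hc.continuousOn
    have hu0 : u ≠ 0 := by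
      rintro rfl
      simp at hu
    refine ⟨_, aux_pos hB u hu0, fun d => ?_⟩
    by_cases hd : d = 0
    · simp [hd]
    · have hmem : (‖d‖⁻¹ • d) ∈ Metric.sphere (0 : Fin n → ℝ) 1 := by
        simp [norm_smul, hd]
      have h := hm hmem
      simp only [Set.mem_ofPred_eq, mulVec_smul, dotProduct_smul, smul_dotProduct,
        smul_eq_mul] at h
      have hp : 0 < ‖d‖ := norm_pos_iff.2 hd
      calc _ ≤ (‖d‖⁻¹ * (‖d‖⁻¹ * (B.mulVec d ⬝ᵥ d))) * ‖d‖ ^ 2 := by gcongr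
        _ = _ := by field_simp

lemma aux_exists {n : ℕ} (A : Matrix (Fin n) (Fin n) ℝ)
    (hA : (A - 1).PosDef) (b : Fin n → ℝ) : ∃ x, ∀ y, auxF A b x ≤ auxF A b y := by
  have hc : Continuous (auxF A b) := by
    unfold auxF
    simp only [dotProduct]
    fun_prop
  obtain ⟨c, hc0, hcB⟩ := aux_coercive hA
  refine hc.exists_forall_le' 0 ?_
  set v := A.mulVec 0 - (fun i => |(0 : Fin n → ℝ) i|) - b with hv
  set K := ∑ i, |v i|
  filter_upwards [(tendsto_norm_cocompact_atTop (E := Fin n → ℝ)).eventually_ge_atTop (2 * K / c)]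
    with d hd
  have h := aux_lower A hA b 0 d
  rw [← hv, zero_add] at h
  have h1 : -(K * ‖d‖) ≤ v ⬝ᵥ d := by
    rw [Finset.sum_mul, dotProduct, ← Finset.sum_neg_distrib]
    refine Finset.sum_le_sum fun i _ => ?_
    have h3 : |v i * d i| ≤ |v i| * ‖d‖ := by
      rw [abs_mul]
      gcongr
      exact norm_le_pi_norm d i
    linarith [neg_abs_le (v i * d i)]
  have h2 := hcB d
  rw [div_le_iff₀ hc0] at hd
  nlinarith [norm_nonneg d]

/-- If `A - I` is symmetric positive definite, the function
`f(x) = ⟨Ax, x⟩ - ⟨|x|, x⟩ - 2⟨b, x⟩` has a unique global minimum point, and a point is the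
global minimizer of `f` iff it solves the AVE `Ax - |x| = b`. -/
theorem stmt_4 (n : ℕ) (A : Matrix (Fin n) (Fin n) ℝ)
    (hA : (A - 1).PosDef) (b : Fin n → ℝ) :
    let f : (Fin n → ℝ) → ℝ := fun x =>
      A.mulVec x ⬝ᵥ x - (fun i => |x i|) ⬝ᵥ x - 2 * (b ⬝ᵥ x)
    (∃! xstar : Fin n → ℝ, ∀ y : Fin n → ℝ, f xstar ≤ f y) ∧
      ∀ xstar : Fin n → ℝ,
        ((∀ y : Fin n → ℝ, f xstar ≤ f y) ↔ A.mulVec xstar - (fun i => |xstar i|) = b) := by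
  intro f
  change (∃! xstar : Fin n → ℝ, ∀ y : Fin n → ℝ, auxF A b xstar ≤ auxF A b y) ∧
      ∀ xstar : Fin n → ℝ, ((∀ y : Fin n → ℝ, auxF A b xstar ≤ auxF A b y) ↔ _)
  refine ⟨?_, aux_iff A hA b⟩
  obtain ⟨x, hx⟩ := aux_exists A hA b
  refine ⟨x, hx, fun y hy => ?_⟩
  have h2 := aux_lower A hA b x (y - x)
  rw [(aux_iff A hA b x).1 hx, sub_self, zero_dotProduct, add_sub_cancel] at h2
  by_contra hne
  have := aux_pos hA _ (sub_ne_zero.2 hne)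
  linarith [hy x]
end

section
/- Let A = [[a₁₁, a₁₂],[a₁₂, a₂₂]] ∈ ℝ^{2×2} and b = (b₁, b₂)ᵀ ∈ ℝ² with A − I symmetric positive definite, and define f(x) = ⟨Ax, x⟩ − ⟨|x|, x⟩ − 2⟨b, x⟩ on ℝ². Let D = a₁₂² − (a₁₁ − 1)(a₂₂ − 1), D₂ = a₁₂² − (a₁₁ − 1)(a₂₂ + 1), D₃ = a₁₂² − (a₁₁ + 1)(a₂₂ − 1), D₄ = a₁₂² − (a₁₁ + 1)(a₂₂ + 1), and set p = ((b₂a₁₂ − b₁(a₂₂ − 1))/D, (b₁a₁₂ − b₂(a₁₁ − 1))/D), q = ((b₂a₁₂ − b₁(a₂₂ + 1))/D₂, (b₁a₁₂ − b₂(a₁₁ − 1))/D₂), r = ((b₂a₁₂ − b₁(a₂₂ − 1))/D₃, (b₁a₁₂ − b₂(a₁₁ + 1))/D₃), s = ((b₂a₁₂ − b₁(a₂₂ + 1))/D₄, (b₁a₁₂ − b₂(a₁₁ + 1))/D₄). Then one of the four points p, q, r, s is the unique global minimum point of f on ℝ². -/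
open Matrix

lemma abs_aux (m x : ℝ) : -(x - m) ^ 2 ≤ 2 * |m| * (x - m) - |x| * x + |m| * m := by
  rcases abs_cases m with ⟨h, h'⟩ | ⟨h, h'⟩ <;> rcases abs_cases x with ⟨k, k'⟩ | ⟨k, k'⟩ <;>
    rw [h, k] <;> nlinarith [sq_nonneg x]

lemma quad_pos (u v c : ℝ) (hu : 0 < u) (hd : c ^ 2 < u * v) (x y : ℝ)
    (h : u * x ^ 2 + 2 * c * x * y + v * y ^ 2 ≤ 0) : x = 0 ∧ y = 0 := by
  have e : u * (u * x ^ 2 + 2 * c * x * y + v * y ^ 2)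
      = (u * x + c * y) ^ 2 + (u * v - c ^ 2) * y ^ 2 := by ring
  have h1 : (u * x + c * y) ^ 2 + (u * v - c ^ 2) * y ^ 2 ≤ 0 := by
    rw [← e]; exact mul_nonpos_of_nonneg_of_nonpos hu.le h
  have hy : y = 0 := by
    by_contra hy
    have : 0 < (u * v - c ^ 2) * y ^ 2 := mul_pos (by linarith) (by positivity)
    nlinarith [sq_nonneg (u * x + c * y)]
  subst hy
  refine ⟨?_, rfl⟩
  by_contra hx
  have : 0 < u * x ^ 2 := by positivity
  nlinarith

lemma crit (a11 a12 a22 b1 b2 : ℝ)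
    (m n : ℝ)
    (h1 : a11 * m + a12 * n - |m| = b1) (h2 : a12 * m + a22 * n - |n| = b2) (x y : ℝ) :
    (a11 - 1) * (x - m) ^ 2 + 2 * a12 * (x - m) * (y - n) + (a22 - 1) * (y - n) ^ 2
    ≤ ((a11 * x + a12 * y) * x + (a12 * x + a22 * y) * y - (|x| * x + |y| * y)
        - 2 * (b1 * x + b2 * y))
      - ((a11 * m + a12 * n) * m + (a12 * m + a22 * n) * n - (|m| * m + |n| * n)
        - 2 * (b1 * m + b2 * n)) := by
  have k1 := abs_aux m x
  have k2 := abs_aux n y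
  subst h1 h2
  nlinarith

lemma signs (u v c b1 b2 : ℝ) (hu : 0 < u) (hv : 0 < v) (hd : c ^ 2 < u * v) :
    (0 ≤ b1 * v - b2 * c ∧ 0 ≤ b2 * u - b1 * c) ∨
    (0 ≤ b1 * (v + 2) - b2 * c ∧ b2 * u - b1 * c ≤ 0) ∨
    (b1 * v - b2 * c ≤ 0 ∧ 0 ≤ b2 * (u + 2) - b1 * c) ∨
    (b1 * (v + 2) - b2 * c ≤ 0 ∧ b2 * (u + 2) - b1 * c ≤ 0) := by
  have key : ∀ u v b1 b2 : ℝ, 0 < u → 0 < v → c ^ 2 < u * v → b1 < 0 → 0 < b2 →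
      0 < b1 * v - b2 * c → b2 * u - b1 * c < 0 → False := by
    intro u v b1 b2 hu hv hd hb1 hb2 h1 h2
    have hc : c < 0 := by
      by_contra hc
      nlinarith [mul_nonneg hb2.le (not_lt.mp hc), mul_pos (neg_pos.mpr hb1) hv]
    have h3 : (b2 * u - b1 * c) * v < 0 := mul_neg_of_neg_of_pos h2 hv
    have h4 : (b1 * v - b2 * c) * c < 0 := mul_neg_of_pos_of_neg h1 hc
    nlinarith [mul_pos hb2 (sub_pos.mpr hd)]
  by_contra hcon
  push Not at hcon
  obtain ⟨g1, g2, g3, g4⟩ := hcon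
  rcases lt_or_ge (b2 * u - b1 * c) 0 with h2 | h2
  · have e1 : b1 * (v + 2) - b2 * c < 0 := by
      by_contra h; have := g2 (not_lt.mp h); linarith
    have e2 := g4 e1.le
    have e3 : 0 < b1 * v - b2 * c := by
      by_contra h; have := g3 (not_lt.mp h); linarith
    exact key u v b1 b2 hu hv hd (by linarith) (by linarith) e3 h2
  · have e1 : b1 * v - b2 * c < 0 := by
      by_contra h; have := g1 (not_lt.mp h); linarith
    have e2 := g3 e1.le
    have e3 : 0 < b1 * (v + 2) - b2 * c := by
      by_contra h; have := g4 (not_lt.mp h); linarith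
    have e4 : 0 < b2 * u - b1 * c := by
      rcases h2.lt_or_eq with h | h
      · exact h
      · exfalso
        have := g2 e3.le
        linarith
    exact key v u b2 b1 hv hu (by linarith) (by linarith) (by linarith) e4 e1

/-- For a 2×2 matrix `A` with `A - I` symmetric positive definite, one of the four candidate
points `p, q, r, s` is the unique global minimum point of
`f(x) = ⟨Ax, x⟩ - ⟨|x|, x⟩ - 2⟨b, x⟩` on `ℝ²`. -/
theorem stmt_9 (a11 a12 a22 b1 b2 : ℝ)
    (hA : (!![a11, a12; a12, a22] - 1).PosDef) :
    let A : Matrix (Fin 2) (Fin 2) ℝ := !![a11, a12; a12, a22]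
    let b : Fin 2 → ℝ := ![b1, b2]
    let f : (Fin 2 → ℝ) → ℝ := fun x =>
      A.mulVec x ⬝ᵥ x - (fun i => |x i|) ⬝ᵥ x - 2 * (b ⬝ᵥ x)
    let D1 := a12 ^ 2 - (a11 - 1) * (a22 - 1)
    let D2 := a12 ^ 2 - (a11 - 1) * (a22 + 1)
    let D3 := a12 ^ 2 - (a11 + 1) * (a22 - 1)
    let D4 := a12 ^ 2 - (a11 + 1) * (a22 + 1)
    let p : Fin 2 → ℝ := ![(b2 * a12 - b1 * (a22 - 1)) / D1, (b1 * a12 - b2 * (a11 - 1)) / D1]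
    let q : Fin 2 → ℝ := ![(b2 * a12 - b1 * (a22 + 1)) / D2, (b1 * a12 - b2 * (a11 - 1)) / D2]
    let r : Fin 2 → ℝ := ![(b2 * a12 - b1 * (a22 - 1)) / D3, (b1 * a12 - b2 * (a11 + 1)) / D3]
    let s : Fin 2 → ℝ := ![(b2 * a12 - b1 * (a22 + 1)) / D4, (b1 * a12 - b2 * (a11 + 1)) / D4]
    ∃ m ∈ ({p, q, r, s} : Set (Fin 2 → ℝ)),
      (∀ x : Fin 2 → ℝ, f m ≤ f x) ∧ ∀ x : Fin 2 → ℝ, (∀ y : Fin 2 → ℝ, f x ≤ f y) → x = m := by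
  intro A b f D1 D2 D3 D4 p q r s
  have hu : 1 < a11 := by
    have := hA.diag_pos (i := 0)
    simp at this
    linarith
  have hv : 1 < a22 := by
    have := hA.diag_pos (i := 1)
    simp at this
    linarith
  have hd : a12 ^ 2 < (a11 - 1) * (a22 - 1) := by
    have := hA.det_pos
    simp [Matrix.det_fin_two] at this
    nlinarith
  have hf : ∀ x : Fin 2 → ℝ, f x = (a11 * x 0 + a12 * x 1) * x 0 + (a12 * x 0 + a22 * x 1) * x 1
      - (|x 0| * x 0 + |x 1| * x 1) - 2 * (b1 * x 0 + b2 * x 1) := by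
    intro x
    simp [f, A, b, Matrix.mulVec, dotProduct, Fin.sum_univ_two]
  have main : ∀ m : Fin 2 → ℝ, m ∈ ({p, q, r, s} : Set (Fin 2 → ℝ)) →
      a11 * m 0 + a12 * m 1 - |m 0| = b1 → a12 * m 0 + a22 * m 1 - |m 1| = b2 →
      ∃ m ∈ ({p, q, r, s} : Set (Fin 2 → ℝ)),
      (∀ x : Fin 2 → ℝ, f m ≤ f x) ∧
        ∀ x : Fin 2 → ℝ, (∀ y : Fin 2 → ℝ, f x ≤ f y) → x = m := by
    intro m hm h1 h2
    have hc := crit a11 a12 a22 b1 b2 (m 0) (m 1) h1 h2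
    refine ⟨m, hm, fun x => ?_, fun x hx => ?_⟩
    · by_contra hlt
      push Not at hlt
      have h3 := hc (x 0) (x 1)
      rw [← hf, ← hf] at h3
      obtain ⟨e0, e1⟩ := quad_pos (a11 - 1) (a22 - 1) a12 (by linarith) hd
        (x 0 - m 0) (x 1 - m 1) (by linarith)
      rw [e0, e1] at h3
      linarith
    · have h3 := hc (x 0) (x 1)
      rw [← hf, ← hf] at h3
      have h4 := hx m
      obtain ⟨e0, e1⟩ := quad_pos (a11 - 1) (a22 - 1) a12 (by linarith) hd
        (x 0 - m 0) (x 1 - m 1) (by linarith)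
      ext i
      fin_cases i
      · exact sub_eq_zero.mp e0
      · exact sub_eq_zero.mp e1
  have hD1 : D1 < 0 := by simp only [D1]; linarith
  have hD2 : D2 < 0 := by simp only [D2]; nlinarith
  have hD3 : D3 < 0 := by simp only [D3]; nlinarith
  have hD4 : D4 < 0 := by simp only [D4]; nlinarith
  rcases signs (a11 - 1) (a22 - 1) a12 b1 b2 (by linarith) (by linarith) hd with
    ⟨g1, g2⟩ | ⟨g1, g2⟩ | ⟨g1, g2⟩ | ⟨g1, g2⟩
  · have hne := hD1.ne
    have k0 : |p 0| = p 0 := abs_of_nonneg (div_nonneg_of_nonpos (by linarith) hD1.le)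
    have k1 : |p 1| = p 1 := abs_of_nonneg (div_nonneg_of_nonpos (by linarith) hD1.le)
    refine main p (by simp) ?_ ?_
    · rw [k0]
      simp only [p, Matrix.cons_val_zero, Matrix.cons_val_one]
      field_simp
      simp only [D1]
      ring
    · rw [k1]
      simp only [p, Matrix.cons_val_zero, Matrix.cons_val_one]
      field_simp
      simp only [D1]
      ring
  · have hne := hD2.ne
    have k0 : |q 0| = q 0 := abs_of_nonneg (div_nonneg_of_nonpos (by linarith) hD2.le)
    have k1 : |q 1| = -q 1 := abs_of_nonpos (div_nonpos_of_nonneg_of_nonpos (by linarith) hD2.le)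
    refine main q (by simp) ?_ ?_
    · rw [k0]
      simp only [q, Matrix.cons_val_zero, Matrix.cons_val_one]
      field_simp
      simp only [D2]
      ring
    · rw [k1]
      simp only [q, Matrix.cons_val_zero, Matrix.cons_val_one]
      field_simp
      simp only [D2]
      ring
  · have hne := hD3.ne
    have k0 : |r 0| = -r 0 := abs_of_nonpos (div_nonpos_of_nonneg_of_nonpos (by linarith) hD3.le)
    have k1 : |r 1| = r 1 := abs_of_nonneg (div_nonneg_of_nonpos (by linarith) hD3.le)
    refine main r (by simp) ?_ ?_
    · rw [k0]
      simp only [r, Matrix.cons_val_zero, Matrix.cons_val_one]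
      field_simp
      simp only [D3]
      ring
    · rw [k1]
      simp only [r, Matrix.cons_val_zero, Matrix.cons_val_one]
      field_simp
      simp only [D3]
      ring
  · have hne := hD4.ne
    have k0 : |s 0| = -s 0 := abs_of_nonpos (div_nonpos_of_nonneg_of_nonpos (by linarith) hD4.le)
    have k1 : |s 1| = -s 1 := abs_of_nonpos (div_nonpos_of_nonneg_of_nonpos (by linarith) hD4.le)
    refine main s (by simp) ?_ ?_
    · rw [k0]
      simp only [s, Matrix.cons_val_zero, Matrix.cons_val_one]
      field_simp
      simp only [D4]
      ring
    · rw [k1]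
      simp only [s, Matrix.cons_val_zero, Matrix.cons_val_one]
      field_simp
      simp only [D4]
      ring
end

section
/- Let a₁₁, a₂₂, a₁₂, b₁, b₂ ∈ ℝ satisfy (a₁₁ − 1)(a₂₂ − 1) > a₁₂², a₁₁ − 1 > 0, a₂₂ − 1 > 0, and define p, q, r, s as in Lemma 3: p = ((b₂a₁₂ − b₁(a₂₂ − 1))/D₁, (b₁a₁₂ − b₂(a₁₁ − 1))/D₁) with D₁ = a₁₂² − (a₁₁ − 1)(a₂₂ − 1); q = ((b₂a₁₂ − b₁(a₂₂ + 1))/D₂, (b₁a₁₂ − b₂(a₁₁ − 1))/D₂) with D₂ = a₁₂² − (a₁₁ − 1)(a₂₂ + 1); r = ((b₂a₁₂ − b₁(a₂₂ − 1))/D₃, (b₁a₁₂ − b₂(a₁₁ + 1))/D₃) with D₃ = a₁₂² − (a₁₁ + 1)(a₂₂ − 1); s = ((b₂a₁₂ − b₁(a₂₂ + 1))/D₄, (b₁a₁₂ − b₂(a₁₁ + 1))/D₄) with D₄ = a₁₂² − (a₁₁ + 1)(a₂₂ + 1). Then at least one of the following four conditions holds: (i) p₁ ≥ 0 and p₂ ≥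 0; (ii) q₁ ≥ 0 and q₂ < 0; (iii) r₁ < 0 and r₂ ≥ 0; (iv) s₁ < 0 and s₂ < 0. -/
/-- At least one of the four candidate minimizers `p, q, r, s` lies in the "correct" quadrant. -/
theorem stmt_14 (a11 a22 a12 b1 b2 : ℝ)
    (h1 : (a11 - 1) * (a22 - 1) > a12 ^ 2) (h2 : a11 - 1 > 0) (h3 : a22 - 1 > 0) :
    let D1 := a12 ^ 2 - (a11 - 1) * (a22 - 1)
    let D2 := a12 ^ 2 - (a11 - 1) * (a22 + 1)
    let D3 := a12 ^ 2 - (a11 + 1) * (a22 - 1)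
    let D4 := a12 ^ 2 - (a11 + 1) * (a22 + 1)
    let p : ℝ × ℝ := ((b2 * a12 - b1 * (a22 - 1)) / D1, (b1 * a12 - b2 * (a11 - 1)) / D1)
    let q : ℝ × ℝ := ((b2 * a12 - b1 * (a22 + 1)) / D2, (b1 * a12 - b2 * (a11 - 1)) / D2)
    let r : ℝ × ℝ := ((b2 * a12 - b1 * (a22 - 1)) / D3, (b1 * a12 - b2 * (a11 + 1)) / D3)
    let s : ℝ × ℝ := ((b2 * a12 - b1 * (a22 + 1)) / D4, (b1 * a12 - b2 * (a11 + 1)) / D4)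
    (p.1 ≥ 0 ∧ p.2 ≥ 0) ∨ (q.1 ≥ 0 ∧ q.2 < 0) ∨ (r.1 < 0 ∧ r.2 ≥ 0) ∨ (s.1 < 0 ∧ s.2 < 0) := by
  intro D1 D2 D3 D4 p q r s
  have d1 : D1 < 0 := by simp only [D1]; linarith
  have d2 : D2 < 0 := by simp only [D2]; linarith
  have d3 : D3 < 0 := by simp only [D3]; linarith
  have d4 : D4 < 0 := by simp only [D4]; linarith
  have ge : ∀ x D : ℝ, D < 0 → (x / D ≥ 0 ↔ x ≤ 0) := fun x D h => by
    rw [ge_iff_le, le_div_iff_of_neg h, zero_mul]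
  have lt : ∀ x D : ℝ, D < 0 → (x / D < 0 ↔ 0 < x) := fun x D h => by
    rw [div_lt_iff_of_neg h, zero_mul]
  simp only [p, q, r, s, ge _ _ d1, ge _ _ d2, ge _ _ d3, lt _ _ d2, lt _ _ d3, lt _ _ d4]
  clear_value D1 D2 D3 D4
  clear p q r s ge lt d1 d2 d3 d4
  by_contra! H
  obtain ⟨H1, H2, H3, H4⟩ := H
  rcases le_or_gt (b1 * a12 - b2 * (a11 - 1)) 0 with hP2 | hP2
  · have hP1 : 0 < b2 * a12 - b1 * (a22 - 1) := by
      by_contra! h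
      exact absurd (H1 h) (not_lt.mpr hP2)
    have hR2 := H3 hP1
    have hQ1 : b2 * a12 - b1 * (a22 + 1) ≤ 0 := by
      by_contra! h
      exact absurd (H4 h) (not_le.mpr hR2)
    have hb1 : 0 < b1 := by linarith
    have hb2 : b2 < 0 := by linarith
    have hc : a12 < 0 := by
      by_contra! h
      nlinarith [mul_pos hb1 h3, mul_nonneg (neg_nonneg.mpr hb2.le) h]
    nlinarith [mul_pos hP1 h2, mul_nonneg_of_nonpos_of_nonpos hP2 hc.le,
      mul_pos hb1 (sub_pos.mpr h1)]
  · have hQ1 : 0 < b2 * a12 - b1 * (a22 + 1) := by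
      by_contra! h
      exact absurd (H2 h) (not_le.mpr hP2)
    have hR2 := H4 hQ1
    have hP1 : b2 * a12 - b1 * (a22 - 1) ≤ 0 := by
      by_contra! h
      exact absurd (H3 h) (not_lt.mpr hR2)
    have hb1 : b1 < 0 := by linarith
    have hb2 : 0 < b2 := by linarith
    have hc : a12 < 0 := by
      by_contra! h
      nlinarith [mul_pos hb2 h2, mul_nonneg (neg_nonneg.mpr hb1.le) h]
    nlinarith [mul_nonneg (sub_nonneg.mpr hP1) h2.le, mul_pos_of_neg_of_neg (neg_lt_zero.mpr hP2) hc,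
      mul_pos (neg_pos.mpr hb1) (sub_pos.mpr h1)]
end

section
/- Let A ∈ ℝ^{n×n} be such that A − I is a symmetric positive definite matrix, let b ∈ ℝ^n, and define f(x) = ⟨Ax, x⟩ − ⟨|x|, x⟩ − 2⟨b, x⟩. Then for every x⁰ ∈ ℝ^n, the level set L(x⁰) = { x ∈ ℝ^n : f(x) ≤ f(x⁰) } is a compact subset of ℝ^n. -/
open Matrix

theorem posDef_coercive_aux (n : ℕ) (M : Matrix (Fin n) (Fin n) ℝ) (hM : M.PosDef) :
    ∃ c : ℝ, 0 < c ∧ ∀ x : Fin n → ℝ, c * ‖x‖ ^ 2 ≤ M.mulVec x ⬝ᵥ x := by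
  have hpos : ∀ x : Fin n → ℝ, x ≠ 0 → 0 < M.mulVec x ⬝ᵥ x := by
    intro x hx
    have h := hM.dotProduct_mulVec_pos hx
    rw [dotProduct_comm]
    simpa using h
  have hcont : Continuous (fun x : Fin n → ℝ => M.mulVec x ⬝ᵥ x) := by
    fun_prop
  rcases (Metric.sphere (0 : Fin n → ℝ) 1).eq_empty_or_nonempty with he | hne
  · refine ⟨1, one_pos, fun x => ?_⟩
    by_cases hx : x = 0
    · simp [hx]
    · exfalso
      have : (‖x‖⁻¹ • x) ∈ Metric.sphere (0 : Fin n → ℝ) 1 := by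
        simp [norm_smul, hx]
      rw [he] at this
      exact this
  · obtain ⟨y, hy, hmin⟩ := (isCompact_sphere (0 : Fin n → ℝ) 1).exists_isMinOn hne
      hcont.continuousOn
    have hy0 : y ≠ 0 := by
      rintro rfl
      simp at hy
    refine ⟨_, hpos y hy0, fun x => ?_⟩
    by_cases hx : x = 0
    · simp [hx]
    · have hmem : (‖x‖⁻¹ • x) ∈ Metric.sphere (0 : Fin n → ℝ) 1 := by
        simp [norm_smul, hx]
      have h : M.mulVec y ⬝ᵥ y ≤ M.mulVec (‖x‖⁻¹ • x) ⬝ᵥ (‖x‖⁻¹ • x) := hmin hmem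
      have hxn : 0 < ‖x‖ := norm_pos_iff.mpr hx
      rw [mulVec_smul, smul_dotProduct, dotProduct_smul, smul_eq_mul, smul_eq_mul] at h
      calc _ ≤ (‖x‖⁻¹ * (‖x‖⁻¹ * (M.mulVec x ⬝ᵥ x))) * ‖x‖ ^ 2 := by gcongr
        _ = _ := by field_simp

/-- If `A - I` is symmetric positive definite, every level set of
`f(x) = ⟨Ax, x⟩ - ⟨|x|, x⟩ - 2⟨b, x⟩` is compact. -/
theorem stmt_16 (n : ℕ) (A : Matrix (Fin n) (Fin n) ℝ)
    (hA : (A - 1).PosDef) (b : Fin n → ℝ) :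
    let f : (Fin n → ℝ) → ℝ := fun x =>
      A.mulVec x ⬝ᵥ x - (fun i => |x i|) ⬝ᵥ x - 2 * (b ⬝ᵥ x)
    ∀ x0 : Fin n → ℝ, IsCompact {x : Fin n → ℝ | f x ≤ f x0} := by
  intro f x0
  have hf : Continuous f := by
    have h : Continuous (fun x : Fin n → ℝ => (fun i => |x i|)) :=
      continuous_pi fun i => (continuous_apply i).abs
    have h2 : Continuous (fun x : Fin n → ℝ => (fun i => |x i|) ⬝ᵥ x) :=
      h.dotProduct continuous_id
    have h3 : Continuous (fun x : Fin n → ℝ => A.mulVec x ⬝ᵥ x) := by fun_prop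
    have h4 : Continuous (fun x : Fin n → ℝ => b ⬝ᵥ x) := by fun_prop
    exact (h3.sub h2).sub (continuous_const.mul h4)
  obtain ⟨c, hc, hq⟩ := posDef_coercive_aux n (A - 1) hA
  set B : ℝ := ∑ i, |b i| with hB
  have hB0 : 0 ≤ B := Finset.sum_nonneg fun i _ => abs_nonneg _
  apply Metric.isCompact_of_isClosed_isBounded (isClosed_le hf continuous_const)
  refine isBounded_iff_forall_norm_le.mpr ⟨1 + (|f x0| + 2 * B) / c, fun x hx => ?_⟩
  have hx' : f x ≤ f x0 := hx
  have hb : b ⬝ᵥ x ≤ B * ‖x‖ := by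
    rw [hB, Finset.sum_mul]
    refine Finset.sum_le_sum fun i _ => ?_
    calc b i * x i ≤ |b i * x i| := le_abs_self _
      _ = |b i| * |x i| := abs_mul _ _
      _ ≤ |b i| * ‖x‖ := by
        gcongr
        exact norm_le_pi_norm x i
  have habs : (fun i => |x i|) ⬝ᵥ x ≤ x ⬝ᵥ x := by
    refine Finset.sum_le_sum fun i _ => ?_
    calc |x i| * x i ≤ |x i| * |x i| := by
          gcongr
          exact le_abs_self _
      _ = x i * x i := abs_mul_abs_self _
  have hqx := hq x
  rw [sub_mulVec, one_mulVec, sub_dotProduct] at hqx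
  have hfx : f x = A.mulVec x ⬝ᵥ x - (fun i => |x i|) ⬝ᵥ x - 2 * (b ⬝ᵥ x) := rfl
  have hK := le_abs_self (f x0)
  have hmain : c * ‖x‖ ^ 2 ≤ |f x0| + 2 * B * ‖x‖ := by linarith
  have hD : 0 ≤ (|f x0| + 2 * B) / c := by positivity
  rcases le_or_gt ‖x‖ 1 with h1 | h1
  · linarith
  · have h2 : ‖x‖ ≤ (|f x0| + 2 * B) / c := by
      rw [le_div_iff₀ hc]
      have h3 : 0 ≤ |f x0| := abs_nonneg _
      have h4 : (‖x‖ * c) * ‖x‖ ≤ (|f x0| + 2 * B) * ‖x‖ := by nlinarith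
      exact le_of_mul_le_mul_right h4 (by linarith)
    linarith
end
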